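/- arXiv:2104.09650 — 5 statements merged into one kernel-verified Lean document; each statement's English description precedes it below -/
import Mathlib

section
/- Let K be a compact subset of ℝⁿ (n ∈ ℕ), let σ : ℝ → ℝ be a continuous function that is not an algebraic polynomial, and let f : K → ℝ be continuous. Then for every ε > 0 there exist d ∈ ℕ, real numbers α_i, b_i (i = 1,…,d) and w_{i,j} (i = 1,…,d, j = 1,…,n) such that the function f̂(x) = Σ_{i=1}^{d} α_i · σ(b_i + Σ_{j=1}^{n} w_{i,j} x_j) satisfies sup_{x ∈ K} |f(x) − f̂(x)| < ε. -/
open Finset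

section Integral

variable {V : Type*} [NormedAddCommGroup V] [NormedSpace ℝ V] [CompleteSpace V]

theorem Submodule.intervalIntegral_mem_of_isClosed (T : Submodule ℝ V)
    (hT : IsClosed (T : Set V)) {c : ℝ → V} (hcT : ∀ u, c u ∈ T) (a b : ℝ) :
    ∫ u in a..b, c u ∈ T := by
  have : CompleteSpace T := hT.completeSpace_coe
  have h := T.subtypeₗᵢ.intervalIntegral_comp_comm (fun u => (⟨c u, hcT u⟩ : T)) (a := a) (b := b)
    (μ := MeasureTheory.volume)
  exact (congrArg (· ∈ T) h).mpr (Subtype.property _)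

theorem Submodule.mem_of_intervalIntegral_mem (T : Submodule ℝ V)
    (hT : IsClosed (T : Set V)) {c : ℝ → V} (hc : Continuous c)
    (h : ∀ w, ∫ u in (0 : ℝ)..w, c u ∈ T) (w : ℝ) : c w ∈ T := by
  have hd : HasDerivAt (fun w => ∫ u in (0 : ℝ)..w, c u) (c w) w :=
    intervalIntegral.integral_hasDerivAt_right (hc.intervalIntegrable _ _)
      hc.stronglyMeasurable.stronglyMeasurableAtFilter hc.continuousAt
  refine hT.mem_of_tendsto hd.tendsto_slope (Filter.Eventually.of_forall fun y => ?_)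
  rw [slope_def_module]
  exact T.smul_mem _ (T.sub_mem (h _) (h _))

end Integral

theorem Continuous.fwdDiff {g : ℝ → ℝ} (hg : Continuous g) (h : ℝ) : Continuous (fwdDiff h g) := by
  unfold _root_.fwdDiff
  fun_prop

theorem Continuous.fwdDiff_iter {g : ℝ → ℝ} (hg : Continuous g) (h : ℝ) (m : ℕ) :
    Continuous ((_root_.fwdDiff h)^[m] g) := by
  induction m with
  | zero => exact hg
  | succ m ih => rw [Function.iterate_succ_apply']; exact ih.fwdDiff h

section Ridge

variable {X : Type*} [TopologicalSpace X]

/-- The function `x ↦ a x ^ k * g (w * a x + b)`. -/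
def weightedRidge (a : C(X, ℝ)) (k : ℕ) (g : ℝ → ℝ) (hg : Continuous g) (w b : ℝ) : C(X, ℝ) where
  toFun x := a x ^ k * g (w * a x + b)

theorem continuous_weightedRidge (a : C(X, ℝ)) (k : ℕ) {g : ℝ → ℝ} (hg : Continuous g)
    {w b : ℝ → ℝ} (hw : Continuous w) (hb : Continuous b) :
    Continuous fun u => weightedRidge a k g hg (w u) (b u) := by
  refine ContinuousMap.continuous_of_continuous_uncurry _ ?_
  simp only [weightedRidge, ContinuousMap.coe_mk, Function.uncurry_def]
  fun_prop

variable [CompactSpace X]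

theorem integral_weightedRidge_fwdDiff (a : C(X, ℝ)) (k : ℕ) {g : ℝ → ℝ} (hg : Continuous g)
    (h w b : ℝ) :
    ∫ u in (0 : ℝ)..w, weightedRidge a (k + 1) (fwdDiff h g) (hg.fwdDiff h) u b =
      (∫ y in (0 : ℝ)..h, weightedRidge a k g hg w (b + y)) -
        ∫ y in (0 : ℝ)..h, weightedRidge a k g hg 0 (b + y) := by
  have integral_apply {c : ℝ → C(X, ℝ)} (hc : Continuous c) (x : X) (s t : ℝ) :
      (∫ u in s..t, c u) x = ∫ u in s..t, c u x :=
    ((ContinuousMap.evalCLM ℝ x).intervalIntegral_comp_comm (hc.intervalIntegrable s t)).symm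
  obtain ⟨G, hG⟩ : ∃ G : ℝ → ℝ, ∀ t, HasDerivAt G (g t) t :=
    ⟨fun t => ∫ u in (0 : ℝ)..t, g u, fun t => intervalIntegral.integral_hasDerivAt_right
      (hg.intervalIntegrable _ _) hg.stronglyMeasurable.stronglyMeasurableAtFilter
      hg.continuousAt⟩
  ext x
  have key (v : ℝ) : ∫ y in (0 : ℝ)..h, a x ^ k * g (v * a x + (b + y)) =
      a x ^ k * (G (v * a x + b + h) - G (v * a x + b)) := by
    rw [intervalIntegral.integral_eq_sub_of_hasDerivAt
      (f := fun y => a x ^ k * G (v * a x + (b + y)))]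
    · simp only [add_zero, add_assoc]; ring
    · intro y _
      refine HasDerivAt.const_mul _ ?_
      simpa [Function.comp_def] using (hG (v * a x + (b + y))).comp y
        (((hasDerivAt_id y).const_add b).const_add (v * a x))
    · exact Continuous.intervalIntegrable (by fun_prop) _ _
  rw [ContinuousMap.sub_apply, integral_apply (continuous_weightedRidge _ _ _ continuous_id' continuous_const),
    integral_apply (continuous_weightedRidge _ _ _ continuous_const (by fun_prop)),
    integral_apply (continuous_weightedRidge _ _ _ continuous_const (by fun_prop))]
  simp only [weightedRidge, ContinuousMap.coe_mk]
  rw [key, key, intervalIntegral.integral_eq_sub_of_hasDerivAt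
    (f := fun u => a x ^ k * (G (u * a x + b + h) - G (u * a x + b)))]
  · intro u _
    have hl (r : ℝ) : HasDerivAt (fun u => G (u * a x + r)) (g (u * a x + r) * a x) u := by
      simpa [Function.comp_def] using (hG (u * a x + r)).comp u (((hasDerivAt_id u).mul_const (a x)).add_const r)
    have := ((hl (b + h)).sub (hl b)).const_mul (a x ^ k)
    simp only [fwdDiff, add_assoc]
    exact this.congr_deriv (by ring)
  · exact Continuous.intervalIntegrable
      (by have := hg.fwdDiff h; fun_prop) _ _

theorem weightedRidge_fwdDiff_mem {T : Submodule ℝ C(X, ℝ)} (hT : IsClosed (T : Set C(X, ℝ)))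
    {a : C(X, ℝ)} {k : ℕ} {g : ℝ → ℝ} (hg : Continuous g)
    (hgT : ∀ w b, weightedRidge a k g hg w b ∈ T) (h w b : ℝ) :
    weightedRidge a (k + 1) (fwdDiff h g) (hg.fwdDiff h) w b ∈ T := by
  refine T.mem_of_intervalIntegral_mem hT
    (continuous_weightedRidge _ _ _ continuous_id' continuous_const) (fun w => ?_) w
  rw [integral_weightedRidge_fwdDiff a k hg h w b]
  exact T.sub_mem (T.intervalIntegral_mem_of_isClosed hT (fun _ => hgT _ _) _ _)
    (T.intervalIntegral_mem_of_isClosed hT (fun _ => hgT _ _) _ _)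

theorem weightedRidge_fwdDiff_iter_mem {T : Submodule ℝ C(X, ℝ)}
    (hT : IsClosed (T : Set C(X, ℝ))) {a : C(X, ℝ)} {g : ℝ → ℝ} (hg : Continuous g)
    (hgT : ∀ w b, weightedRidge a 0 g hg w b ∈ T) (m : ℕ) (h w b : ℝ) :
    weightedRidge a m ((fwdDiff h)^[m] g) (hg.fwdDiff_iter h m) w b ∈ T := by
  induction m generalizing w b with
  | zero => exact hgT w b
  | succ m ih =>
    simpa only [Function.iterate_succ_apply'] using
      weightedRidge_fwdDiff_mem hT (hg.fwdDiff_iter h m) ih h w b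

theorem pow_mem_of_fwdDiff_iter_ne_zero {T : Submodule ℝ C(X, ℝ)}
    (hT : IsClosed (T : Set C(X, ℝ))) {a : C(X, ℝ)} {g : ℝ → ℝ} (hg : Continuous g)
    (hgT : ∀ w b, weightedRidge a 0 g hg w b ∈ T) {m : ℕ} {h b : ℝ}
    (hne : (fwdDiff h)^[m] g b ≠ 0) : a ^ m ∈ T := by
  have hmem := T.smul_mem ((fwdDiff h)^[m] g b)⁻¹
    (weightedRidge_fwdDiff_iter_mem hT hg hgT m h 0 b)
  convert hmem using 1
  ext x
  simp only [weightedRidge, ContinuousMap.pow_apply, ContinuousMap.smul_apply,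
    ContinuousMap.coe_mk, zero_mul, zero_add, smul_eq_mul]
  field_simp

end Ridge

section Frechet

open Polynomial in
theorem exists_polynomial_eval_natCast_eq_choose (k : ℕ) :
    ∃ q : ℝ[X], ∀ n : ℕ, q.eval (n : ℝ) = n.choose k :=
  ⟨C ((k.factorial : ℝ)⁻¹) * descPochhammer ℝ k, fun n => by
    rw [Nat.cast_choose_eq_descPochhammer_div, eval_mul, eval_C, div_eq_inv_mul]⟩

open Polynomial in
/-- A function whose `m`-th forward differences of step `h` vanish is a polynomial on every
arithmetic progression of step `h`. -/
theorem exists_polynomial_of_fwdDiff_iter_eq_zero {g : ℝ → ℝ} {m : ℕ} {h : ℝ} (hh : h ≠ 0)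
    (hg : ∀ b, (fwdDiff h)^[m] g b = 0) (y : ℝ) :
    ∃ P : ℝ[X], ∀ n : ℕ, g (y + n * h) = P.eval (y + n * h) := by
  choose q hq using exists_polynomial_eval_natCast_eq_choose
  have hz (k : ℕ) (hk : m ≤ k) : (fwdDiff h)^[k] g y = 0 := by
    obtain ⟨j, rfl⟩ := Nat.exists_eq_add_of_le' hk
    rw [Function.iterate_add_apply, show (fwdDiff h)^[m] g = fun _ => 0 from funext hg,
      fwdDiff_iter_eq_sum_shift]
    simp
  refine ⟨(∑ k ∈ range m, C ((fwdDiff h)^[k] g y) * q k).comp (C h⁻¹ * (X - C y)), fun n => ?_⟩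
  have hn := shift_eq_sum_fwdDiff_iter h g n y
  simp only [nsmul_eq_mul] at hn
  have harg : h⁻¹ * (y + n * h - y) = n := by field_simp; ring
  simp only [hn, eval_comp, eval_mul, eval_C, eval_sub, eval_X, harg, eval_finsetSum, hq]
  rw [sum_subset (range_mono (le_max_left (n + 1) m)) fun k _ hk => by
      simp [Nat.choose_eq_zero_of_lt (by simpa using hk : n < k)],
    sum_subset (range_mono (le_max_right (n + 1) m)) fun k _ hk => by
      simp [hz k (by simpa using hk)]]
  exact sum_congr rfl fun k _ => mul_comm _ _

open Polynomial in
/-- Fréchet's characterization of polynomials, for continuous functions. -/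
theorem exists_polynomial_of_forall_fwdDiff_iter_eq_zero {g : ℝ → ℝ} (hgc : Continuous g) {m : ℕ}
    (hg : ∀ h b, (fwdDiff h)^[m] g b = 0) : ∃ P : ℝ[X], ∀ t, g t = P.eval t := by
  have hstep (N : ℕ) : ((N : ℝ) + 1)⁻¹ ≠ 0 := by positivity
  choose P hP using fun M N : ℕ =>
    exists_polynomial_of_fwdDiff_iter_eq_zero (hstep N) (hg _) (-(M : ℝ))
  have hnat (M N j : ℕ) : g j = (P M N).eval (j : ℝ) := by
    have := hP M N ((j + M) * (N + 1))
    have harg : -(M : ℝ) + (((j + M) * (N + 1) : ℕ) : ℝ) * ((N : ℝ) + 1)⁻¹ = j := by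
      push_cast; field_simp; ring
    rwa [harg] at this
  have heq (M N : ℕ) : P M N = P 0 0 := by
    refine eq_of_infinite_eval_eq _ _ <|
      (Set.infinite_range_of_injective (Nat.cast_injective (R := ℝ))).mono ?_
    rintro _ ⟨j, rfl⟩
    exact (hnat M N j).symm.trans (hnat 0 0 j)
  refine ⟨P 0 0, congrFun <| Rat.denseRange_cast.equalizer hgc (P 0 0).continuous ?_⟩
  ext r
  have hnum : (0 : ℤ) ≤ r.num + r.num.natAbs * r.den := by
    have : (1 : ℤ) ≤ r.den := by exact_mod_cast r.den_pos
    have h2 : -r.num ≤ r.num.natAbs := by omega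
    nlinarith [Int.natCast_nonneg r.num.natAbs]
  obtain ⟨n, hn⟩ := Int.eq_ofNat_of_zero_le hnum
  obtain ⟨N, hN⟩ := Nat.exists_eq_succ_of_ne_zero r.den_ne_zero
  have := hP r.num.natAbs N n
  have harg : -(r.num.natAbs : ℝ) + (n : ℝ) * ((N : ℝ) + 1)⁻¹ = r := by
    have hn' : (r.num : ℝ) + (r.num.natAbs : ℝ) * r.den = n := by
      have := congrArg (Int.cast (R := ℝ)) hn
      simpa only [Int.cast_add, Int.cast_mul, Int.cast_natCast] using this
    have hN' : (r.den : ℝ) = N + 1 := by rw [hN]; push_cast; ring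
    rw [Rat.cast_def, ← hn', ← hN']
    field_simp
    ring
  rwa [harg, heq] at this

end Frechet

section Density

/-- Closed subspaces containing all powers of the functions in a point-separating subspace `L`
are everything. -/
theorem Submodule.eq_top_of_pow_mem {X : Type*} [TopologicalSpace X] [CompactSpace X]
    {T : Submodule ℝ C(X, ℝ)} (hT : IsClosed (T : Set C(X, ℝ))) (L : Submodule ℝ C(X, ℝ))
    (hsep : ∀ x y, x ≠ y → ∃ a ∈ L, a x ≠ a y) (hpow : ∀ a ∈ L, ∀ m : ℕ, a ^ m ∈ T) :
    T = ⊤ := by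
  let S : Submonoid C(X, ℝ) :=
    { carrier := Set.image NormedSpace.exp (L : Set C(X, ℝ))
      one_mem' := ⟨0, L.zero_mem, NormedSpace.exp_zero⟩
      mul_mem' := by
        rintro _ _ ⟨a, ha, rfl⟩ ⟨b, hb, rfl⟩
        exact ⟨a + b, L.add_mem ha hb, NormedSpace.exp_add⟩ }
  have hST : (S : Set C(X, ℝ)) ⊆ T := by
    rintro _ ⟨a, ha, rfl⟩
    exact hT.mem_of_tendsto (NormedSpace.exp_series_hasSum_exp' (𝕂 := ℝ) a)
      (Filter.Eventually.of_forall fun s => T.sum_mem fun m _ => T.smul_mem _ (hpow a ha m))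
  have hexp (a : C(X, ℝ)) (x : X) : (NormedSpace.exp a) x = Real.exp (a x) := by
    rw [Real.exp_eq_exp_ℝ]
    exact NormedSpace.map_exp (ContinuousMap.evalAlgHom ℝ ℝ x)
      (ContinuousMap.evalCLM ℝ x).continuous a
  have hA : (Algebra.adjoin ℝ (S : Set C(X, ℝ))).SeparatesPoints := by
    intro x y hxy
    obtain ⟨a, ha, hne⟩ := hsep x y hxy
    refine ⟨_, ⟨NormedSpace.exp a, Algebra.subset_adjoin ⟨a, ha, rfl⟩, rfl⟩, ?_⟩
    simpa [hexp] using hne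
  have hle : Subalgebra.toSubmodule (Algebra.adjoin ℝ (S : Set C(X, ℝ))) ≤ T := by
    rw [Algebra.adjoin_eq_span, Submonoid.closure_eq]
    exact Submodule.span_le.2 hST
  rw [eq_top_iff]
  intro f _
  have hf := ContinuousMap.continuousMap_mem_subalgebra_closure_of_separatesPoints _ hA f
  exact closure_minimal (show _ ⊆ (T : Set C(X, ℝ)) from hle) hT hf

end Density

/-- Universal approximation theorem for one-hidden-layer neural networks on a
compact subset of ℝⁿ with a continuous non-polynomial activation function. -/
theorem universal_approximation_nn
    (n : ℕ) (K : Set (Fin n → ℝ)) (hK : IsCompact K)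
    (σ : ℝ → ℝ) (hσc : Continuous σ)
    (hσp : ¬ ∃ q : Polynomial ℝ, ∀ t : ℝ, σ t = q.eval t)
    (f : (Fin n → ℝ) → ℝ) (hf : ContinuousOn f K)
    (ε : ℝ) (hε : 0 < ε) :
    ∃ (d : ℕ) (α b : Fin d → ℝ) (w : Fin d → Fin n → ℝ),
      ∀ x ∈ K, |f x - ∑ i, α i * σ (b i + ∑ j, w i j * x j)| < ε := by
  have : CompactSpace K := isCompact_iff_compactSpace.mp hK
  let linear : (Fin n → ℝ) →ₗ[ℝ] C(K, ℝ) :=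
    { toFun w := ⟨fun x => ∑ j, w j * x.1 j, continuous_finsetSum _ fun j _ =>
        continuous_const.mul ((continuous_apply j).comp continuous_subtype_val)⟩
      map_add' v w := by ext x; simp [add_mul, sum_add_distrib]
      map_smul' r w := by ext x; simp [mul_sum, mul_assoc] }
  let neuron (p : ℝ × (Fin n → ℝ)) : C(K, ℝ) := ⟨fun x => σ (p.1 + linear p.2 x), by fun_prop⟩
  let S := Submodule.span ℝ (Set.range neuron)
  have htop : S.topologicalClosure = ⊤ := by
    refine Submodule.eq_top_of_pow_mem S.isClosed_topologicalClosure (LinearMap.range linear)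
      (fun x y hxy => ?_) ?_
    · obtain ⟨j, hj⟩ := Function.ne_iff.mp (Subtype.coe_ne_coe.mpr hxy)
      exact ⟨linear (Pi.single j 1), ⟨_, rfl⟩, by simpa [linear, Pi.single_apply] using hj⟩
    · rintro _ ⟨v, rfl⟩ m
      obtain ⟨h, b, hne⟩ : ∃ h b, (fwdDiff h)^[m] σ b ≠ 0 := by
        by_contra! hzero
        exact hσp (exists_polynomial_of_forall_fwdDiff_iter_eq_zero hσc hzero)
      refine pow_mem_of_fwdDiff_iter_ne_zero S.isClosed_topologicalClosure hσc (fun w b => ?_) hne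
      refine S.le_topologicalClosure (Submodule.subset_span ⟨(b, w • v), ?_⟩)
      ext x
      simp [neuron, weightedRidge, add_comm]
  obtain ⟨F, hF⟩ : ∃ F : C(K, ℝ), ∀ x : K, F x = f x := ⟨⟨_, hf.domRestrict⟩, fun _ => rfl⟩
  have hmem : F ∈ closure (S : Set C(K, ℝ)) := by
    rw [← Submodule.topologicalClosure_coe, htop]
    trivial
  obtain ⟨g, hgS, hg⟩ := Metric.mem_closure_iff.mp hmem ε hε
  obtain ⟨d, α, p, rfl⟩ := Submodule.mem_span_set'.mp hgS
  choose q hq using fun i => (p i).2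
  refine ⟨d, α, fun i => (q i).1, fun i => (q i).2, fun x hx => ?_⟩
  have := (ContinuousMap.dist_apply_le_dist (⟨x, hx⟩ : K)).trans_lt hg
  simpa [Real.dist_eq, hF, ← hq, neuron, linear] using this
end

section
/- Let X be a compact metric space, let P be a compact subset of the space of Borel probability measures on X equipped with the topology of weak convergence, let M be a dense subset of C(X) (continuous real-valued functions on X with the supremum norm), and let σ : ℝ → ℝ be continuous and not an algebraic polynomial. Then the set of functions F : P → ℝ of the form F(p) = Σ_{i=1}^{d} α_i · σ(b_i + Σ_{j=1}^{m_i} w_{i,j} ∫_X f_{i,j}(x) dp(x)), where d, m_i ∈ ℕ, α_i, b_i, w_{i,j} ∈ ℝ and f_{i,j} ∈ M, is dense in C(P) with respect to the supremum norm. -/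
open Finset MeasureTheory
open Filter Topology ContinuousLinearMap Set
open scoped ContDiff Convolution

/-- Every real polynomial has a polynomial antiderivative. -/
lemma Polynomial.exists_derivative_eq (q : Polynomial ℝ) :
    ∃ r : Polynomial ℝ, r.derivative = q := by
  induction q using Polynomial.induction_on' with
  | add p q hp hq =>
    obtain ⟨r, rfl⟩ := hp
    obtain ⟨s, rfl⟩ := hq
    exact ⟨r + s, Polynomial.derivative_add⟩
  | monomial n a =>
    refine ⟨Polynomial.monomial (n + 1) (a / (n + 1)), ?_⟩
    rw [Polynomial.derivative_monomial]
    have : (n : ℝ) + 1 ≠ 0 := by positivity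
    simp only [Nat.add_sub_cancel, Nat.cast_add, Nat.cast_one]
    congr 1
    field_simp

/-- A smooth function whose `k`-th derivative vanishes identically is a polynomial of degree
less than `k`. -/
lemma exists_polynomial_of_iteratedDeriv_eq_zero (k : ℕ) {g : ℝ → ℝ} (hg : ContDiff ℝ ∞ g)
    (h : ∀ t, iteratedDeriv k g t = 0) :
    ∃ q : Polynomial ℝ, q.degree < k ∧ ∀ t, g t = q.eval t := by
  induction k generalizing g with
  | zero => exact ⟨0, by simp, fun t => by simpa using h t⟩
  | succ k ih =>
    have hd : ContDiff ℝ ∞ (deriv g) := (contDiff_infty_iff_deriv.1 hg).2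
    obtain ⟨q, hq, hgq⟩ := ih hd (fun t => by rw [← iteratedDeriv_succ']; exact h t)
    obtain ⟨r, rfl⟩ := q.exists_derivative_eq
    have hconst : ∀ t, g t - r.eval t = g 0 - r.eval 0 := by
      intro t
      refine is_const_of_deriv_eq_zero (f := fun t => g t - r.eval t) ?_ ?_ t 0
      · exact (hg.differentiable (by simp)).sub r.differentiable
      · intro s
        rw [deriv_fun_sub ((hg.differentiable (by simp)) s) r.differentiableAt, hgq,
          Polynomial.deriv, sub_self]
    refine ⟨r + Polynomial.C (g 0 - r.eval 0), ?_, fun t => ?_⟩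
    · refine (Polynomial.degree_add_le _ _).trans_lt (max_lt ?_ ?_)
      · by_contra! hr
        have h0 : r.natDegree ≠ 0 := fun h0 => by
          rw [Polynomial.eq_C_of_natDegree_eq_zero h0] at hr
          have := hr.trans Polynomial.degree_C_le
          norm_cast at this
        rw [Polynomial.degree_derivative h0] at hq
        have h1 : r.natDegree - 1 < k := by exact_mod_cast hq
        have h2 : k + 1 ≤ r.natDegree := by
          refine Polynomial.le_natDegree_of_coe_le_degree ?_
          exact_mod_cast hr
        omega
      · exact Polynomial.degree_C_le.trans_lt (by exact_mod_cast k.succ_pos)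
    · rw [Polynomial.eval_add, Polynomial.eval_C, ← hconst t]
      ring

/-- A pointwise limit of polynomials of uniformly bounded degree is a polynomial. -/
lemma exists_polynomial_of_tendsto {ι : Type*} {l : Filter ι} [l.NeBot] (k : ℕ)
    {q : ι → Polynomial ℝ} (hq : ∀ i, (q i).degree < k) {f : ℝ → ℝ}
    (hf : ∀ t, Tendsto (fun i => (q i).eval t) l (𝓝 (f t))) :
    ∃ r : Polynomial ℝ, ∀ t, f t = r.eval t := by
  let v : ℕ → ℝ := fun n => n
  have hv : Set.InjOn v (Finset.range k) := fun a _ b _ hab => Nat.cast_injective hab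
  refine ⟨Lagrange.interpolate (Finset.range k) v (fun n => f (v n)), fun t => ?_⟩
  refine tendsto_nhds_unique (hf t) ?_
  have : ∀ i, (q i).eval t
      = ∑ n ∈ Finset.range k, (q i).eval (v n) * (Lagrange.basis (Finset.range k) v n).eval t := by
    intro i
    have := Lagrange.eq_interpolate hv (f := q i) (by simpa using hq i)
    conv_lhs => rw [this]
    simp [Lagrange.interpolate_apply, Polynomial.eval_finsetSum]
  simp only [this, Lagrange.interpolate_apply, Polynomial.eval_finsetSum, Polynomial.eval_mul,
    Polynomial.eval_C]
  exact tendsto_finsetSum _ fun n _ => (hf (v n)).mul_const _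

/-- Every derivative of a continuous non-polynomial function, taken in the sense of
mollification, is non-trivial. -/
lemma exists_bump_iteratedDeriv_ne_zero {σ : ℝ → ℝ} (hσc : Continuous σ)
    (hσp : ¬ ∃ q : Polynomial ℝ, ∀ t : ℝ, σ t = q.eval t) (k : ℕ) :
    ∃ (φ : ContDiffBump (0 : ℝ)) (b : ℝ),
      iteratedDeriv k (φ.normed volume ⋆[lsmul ℝ ℝ, volume] σ) b ≠ 0 := by
  by_contra! hcon
  apply hσp
  let φ : ℕ → ContDiffBump (0 : ℝ) := fun n =>
    ⟨1 / (2 * ((n : ℝ) + 1)), 1 / ((n : ℝ) + 1), by positivity, by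
      have : (0 : ℝ) ≤ n := n.cast_nonneg
      exact one_div_lt_one_div_of_lt (by positivity) (by linarith)⟩
  have hq : ∀ n, ∃ q : Polynomial ℝ, q.degree < k ∧
      ∀ t, ((φ n).normed volume ⋆[lsmul ℝ ℝ, volume] σ) t = q.eval t := fun n =>
    exists_polynomial_of_iteratedDeriv_eq_zero k
      ((φ n).hasCompactSupport_normed.contDiff_convolution_left _ (φ n).contDiff_normed
        hσc.locallyIntegrable) (hcon (φ n))
  choose q hqd hq using hq
  refine exists_polynomial_of_tendsto (l := atTop) k hqd fun t => ?_
  simp only [← hq]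
  exact ContDiffBump.convolution_tendsto_right_of_continuous
    (tendsto_one_div_add_atTop_nhds_zero_nat) hσc t

/-- The integral of a continuous compactly supported function with values in a closed subspace
lies in that subspace. -/
lemma Submodule.integral_mem_of_hasCompactSupport {E : Type*} [NormedAddCommGroup E]
    [NormedSpace ℝ E] [CompleteSpace E] {S : Submodule ℝ E} (hS : IsClosed (S : Set E))
    {F : ℝ → E} (hF : Continuous F) (hFc : HasCompactSupport F) (hFS : ∀ s, F s ∈ S) :
    ∫ s, F s ∈ S := by
  have : CompleteSpace S := hS.completeSpace_coe
  let f : ℝ → S := fun s => ⟨F s, hFS s⟩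
  have hf : Continuous f := hF.subtype_mk _
  have hfc : HasCompactSupport f := by
    refine hFc.mono fun s hs => ?_
    simpa [f, Subtype.ext_iff] using hs
  have hint : ∫ s, F s = S.subtypeL (∫ s, f s) :=
    S.subtypeL.integral_comp_comm (hf.integrable_of_hasCompactSupport hfc (μ := volume))
  rw [hint]
  exact (∫ s, f s).2

section Ridge

variable {Y : Type*} [TopologicalSpace Y] [CompactSpace Y]

/-- A closed subspace containing all translates `σ ∘ (ℓ + b)` contains the mollifications
of `σ` composed with `ℓ`. -/
lemma ContinuousMap.convolution_comp_mem {S : Submodule ℝ C(Y, ℝ)}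
    (hS : IsClosed (S : Set C(Y, ℝ))) (σ g : C(ℝ, ℝ)) (φ : ContDiffBump (0 : ℝ))
    (hg : ∀ t, g t = (φ.normed volume ⋆[lsmul ℝ ℝ, volume] σ) t) (ℓ : C(Y, ℝ))
    (h : ∀ b : ℝ, σ.comp (ℓ + ContinuousMap.const Y b) ∈ S) :
    g.comp ℓ ∈ S := by
  let F : ℝ → C(Y, ℝ) := fun s =>
    φ.normed volume s • σ.comp (ℓ + ContinuousMap.const Y (-s))
  have hF : Continuous F := by
    refine φ.continuous_normed.smul ?_
    exact ContinuousMap.continuous_postcomp σ |>.comp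
      (continuous_const.add (ContinuousMap.continuous_const'.comp continuous_neg))
  have hFc : HasCompactSupport F := φ.hasCompactSupport_normed.smul_right
  have key := Submodule.integral_mem_of_hasCompactSupport hS hF hFc
    (fun s => S.smul_mem _ (h (-s)))
  convert key using 1
  ext y
  have := (ContinuousMap.evalCLM ℝ y).integral_comp_comm
    (hF.integrable_of_hasCompactSupport hFc (μ := volume))
  rw [ContinuousMap.comp_apply, hg]
  refine Eq.trans ?_ this
  simp [convolution_lsmul, F, sub_eq_add_neg]

/-- Differentiating `w ↦ u * F (w ℓ + b)` inside a closed subspace. -/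
lemma ContinuousMap.mul_deriv_comp_mem {S : Submodule ℝ C(Y, ℝ)}
    (hS : IsClosed (S : Set C(Y, ℝ))) (ℓ u : C(Y, ℝ)) (F F' : C(ℝ, ℝ))
    (hF : ∀ t, HasDerivAt F (F' t) t)
    (h : ∀ w b : ℝ, u * F.comp (w • ℓ + ContinuousMap.const Y b) ∈ S) (w b : ℝ) :
    u * ℓ * F'.comp (w • ℓ + ContinuousMap.const Y b) ∈ S := by
  let I : C(ℝ × Y, ℝ) :=
    ⟨fun z => ∫ s in (0 : ℝ)..1, F' ((w * ℓ z.2 + b) + s * (z.1 * ℓ z.2)), by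
      apply intervalIntegral.continuous_parametric_intervalIntegral_of_continuous'
      fun_prop⟩
  let Φ : ℝ → C(Y, ℝ) := fun r => u * ℓ * I.curry r
  have hΦ : Continuous Φ := continuous_const.mul I.curry.continuous
  have hI : ∀ r y, r * ℓ y * I.curry r y = F (w * ℓ y + b + r * ℓ y) - F (w * ℓ y + b) := by
    intro r y
    have hd : ∀ s ∈ uIcc (0 : ℝ) 1, HasDerivAt (fun s => F ((w * ℓ y + b) + s * (r * ℓ y)))
        (F' ((w * ℓ y + b) + s * (r * ℓ y)) * (r * ℓ y)) s := by
      intro s _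
      have h1 : HasDerivAt (fun s => (w * ℓ y + b) + s * (r * ℓ y)) (r * ℓ y) s := by
        simpa using ((hasDerivAt_id s).mul_const (r * ℓ y)).const_add (w * ℓ y + b)
      exact (hF _).comp s h1
    have := intervalIntegral.integral_eq_sub_of_hasDerivAt hd
      (Continuous.intervalIntegrable (by fun_prop) _ _)
    rw [intervalIntegral.integral_mul_const] at this
    simp only [one_mul, zero_mul, add_zero] at this
    rw [← this, mul_comm]
    rfl
  have hmem : ∀ r, r ≠ 0 → Φ r ∈ S := by
    intro r hr
    have : Φ r = r⁻¹ • (u * F.comp ((w + r) • ℓ + ContinuousMap.const Y b)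
        - u * F.comp (w • ℓ + ContinuousMap.const Y b)) := by
      ext y
      have e : (w + r) * ℓ y + b = w * ℓ y + b + r * ℓ y := by ring
      simp only [Φ, ContinuousMap.mul_apply, ContinuousMap.smul_apply, ContinuousMap.sub_apply,
        ContinuousMap.comp_apply, ContinuousMap.add_apply, ContinuousMap.const_apply, smul_eq_mul,
        e, ← mul_sub, ← hI]
      field_simp
    rw [this]
    exact S.smul_mem _ (S.sub_mem (h _ _) (h _ _))
  have h0 : Φ 0 ∈ S := by
    have ht : Tendsto Φ (𝓝[≠] 0) (𝓝 (Φ 0)) := (hΦ.tendsto 0).mono_left nhdsWithin_le_nhds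
    exact hS.mem_of_tendsto ht (eventually_nhdsWithin_of_forall hmem)
  convert h0 using 1
  ext y
  simp [Φ, I]

/-- Powers of `ℓ` lie in every closed subspace containing all the `σ ∘ (w ℓ + b)`. -/
lemma ContinuousMap.pow_mem_of_comp_affine_mem {S : Submodule ℝ C(Y, ℝ)}
    (hS : IsClosed (S : Set C(Y, ℝ))) (σ : C(ℝ, ℝ))
    (hσp : ¬ ∃ q : Polynomial ℝ, ∀ t : ℝ, σ t = q.eval t) (ℓ : C(Y, ℝ))
    (h : ∀ w b : ℝ, σ.comp (w • ℓ + ContinuousMap.const Y b) ∈ S) (k : ℕ) :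
    ℓ ^ k ∈ S := by
  obtain ⟨φ, b, hb⟩ := exists_bump_iteratedDeriv_ne_zero σ.continuous hσp k
  set g : ℝ → ℝ := φ.normed volume ⋆[lsmul ℝ ℝ, volume] σ with hgdef
  have hg : ContDiff ℝ ∞ g := φ.hasCompactSupport_normed.contDiff_convolution_left _
    φ.contDiff_normed σ.continuous.locallyIntegrable
  have hgc : ∀ n : ℕ, Continuous (iteratedDeriv n g) := fun n =>
    hg.continuous_iteratedDeriv n (by exact_mod_cast le_top)
  let G : ℕ → C(ℝ, ℝ) := fun n => ⟨iteratedDeriv n g, hgc n⟩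
  have hG : ∀ n (w b : ℝ), ℓ ^ n * (G n).comp (w • ℓ + ContinuousMap.const Y b) ∈ S := by
    intro n
    induction n with
    | zero =>
      intro w b
      rw [pow_zero, one_mul]
      refine ContinuousMap.convolution_comp_mem hS σ (G 0) φ (fun t => by simp [G, hgdef]) _ ?_
      intro c
      convert h w (b + c) using 2
      ext y
      simp [add_assoc]
    | succ n ih =>
      intro w b
      rw [pow_succ]
      refine ContinuousMap.mul_deriv_comp_mem hS ℓ (ℓ ^ n) (G n) (G (n + 1)) (fun t => ?_) ih w b
      have hd : DifferentiableAt ℝ (iteratedDeriv n g) t :=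
        hg.differentiable_iteratedDeriv n (by exact_mod_cast WithTop.coe_lt_top n) t
      have := hd.hasDerivAt
      rwa [← iteratedDeriv_succ] at this
  have := S.smul_mem (iteratedDeriv k g b)⁻¹ (hG k 0 b)
  convert this using 1
  ext y
  simp [G]
  field_simp

/-- Let `L` be a separating vector space of continuous functions containing the constants. If
`σ` is not a polynomial, a closed subspace containing `σ ∘ ℓ` for all `ℓ ∈ L` is everything. -/
theorem ContinuousMap.eq_top_of_comp_mem {S : Submodule ℝ C(Y, ℝ)}
    (hS : IsClosed (S : Set C(Y, ℝ))) (σ : C(ℝ, ℝ))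
    (hσp : ¬ ∃ q : Polynomial ℝ, ∀ t : ℝ, σ t = q.eval t) (L : Submodule ℝ C(Y, ℝ))
    (hL1 : ∀ b : ℝ, ContinuousMap.const Y b ∈ L)
    (hLsep : ∀ x y : Y, x ≠ y → ∃ ℓ ∈ L, ℓ x ≠ ℓ y)
    (h : ∀ ℓ ∈ L, σ.comp ℓ ∈ S) : S = ⊤ := by
  let E : C(ℝ, ℝ) := ⟨Real.exp, Real.continuous_exp⟩
  have hexp : ∀ ℓ ∈ L, E.comp ℓ ∈ S := by
    intro ℓ hℓ
    have hpow : ∀ k, ℓ ^ k ∈ S := ContinuousMap.pow_mem_of_comp_affine_mem hS σ hσp ℓ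
      fun w b => h _ (L.add_mem (L.smul_mem w hℓ) (hL1 b))
    have hs := NormedSpace.exp_series_hasSum_exp' (𝕂 := ℝ) ℓ
    have hmem : NormedSpace.exp ℓ ∈ S :=
      hS.mem_of_tendsto hs (Eventually.of_forall fun s =>
        S.sum_mem fun k _ => S.smul_mem _ (hpow k))
    convert hmem using 1
    ext y
    have h1 := (ContinuousMap.evalCLM ℝ y).hasSum hs
    have h2 := NormedSpace.exp_series_hasSum_exp' (𝕂 := ℝ) (ℓ y)
    rw [← Real.exp_eq_exp_ℝ] at h2
    refine h2.unique ?_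
    simpa using h1
  let N : Submonoid C(Y, ℝ) :=
    { carrier := {f | ∃ ℓ ∈ L, E.comp ℓ = f}
      one_mem' := ⟨0, L.zero_mem, by ext; simp [E]⟩
      mul_mem' := by
        rintro _ _ ⟨ℓ, hℓ, rfl⟩ ⟨ℓ', hℓ', rfl⟩
        exact ⟨ℓ + ℓ', L.add_mem hℓ hℓ', by ext; simp [E, Real.exp_add]⟩ }
  let A : Subalgebra ℝ C(Y, ℝ) := Algebra.adjoin ℝ (N : Set C(Y, ℝ))
  have hAS : Subalgebra.toSubmodule A ≤ S := by
    rw [Algebra.adjoin_eq_span, Submonoid.closure_eq, Submodule.span_le]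
    rintro _ ⟨ℓ, hℓ, rfl⟩
    exact hexp ℓ hℓ
  have hA : A.SeparatesPoints := by
    intro x y hxy
    obtain ⟨ℓ, hℓ, hne⟩ := hLsep x y hxy
    refine ⟨E.comp ℓ, ⟨E.comp ℓ, Algebra.subset_adjoin ⟨ℓ, hℓ, rfl⟩, rfl⟩, ?_⟩
    simpa [E] using hne
  have htop := ContinuousMap.subalgebra_topologicalClosure_eq_top_of_separatesPoints A hA
  rw [eq_top_iff]
  intro f _
  have hf : f ∈ A.topologicalClosure := htop ▸ Algebra.mem_top
  exact closure_minimal (show (A : Set C(Y, ℝ)) ⊆ S from hAS) hS hf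

end Ridge

section Measures

variable {X : Type*} [MetricSpace X] [CompactSpace X] [MeasurableSpace X] [BorelSpace X]

lemma ContinuousMap.integrable_probabilityMeasure (f : C(X, ℝ)) (p : ProbabilityMeasure X) :
    Integrable f (p : Measure X) :=
  f.continuous.integrable_of_hasCompactSupport (HasCompactSupport.of_compactSpace f)

/-- The linear map sending `f` to the function `p ↦ ∫ f dp` on a set of probability measures. -/
noncomputable def integralPairing (P : Set (ProbabilityMeasure X)) : C(X, ℝ) →ₗ[ℝ] C(P, ℝ) where
  toFun f :=
    ⟨fun p => ∫ x, f x ∂((p : ProbabilityMeasure X) : Measure X),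
      (ProbabilityMeasure.continuous_integral_boundedContinuousFunction
        (BoundedContinuousFunction.mkOfCompact f)).comp continuous_subtype_val⟩
  map_add' f g := by
    ext p
    exact integral_add (f.integrable_probabilityMeasure p) (g.integrable_probabilityMeasure p)
  map_smul' c f := by
    ext p
    exact integral_const_mul c _

@[simp]
lemma integralPairing_apply (P : Set (ProbabilityMeasure X)) (f : C(X, ℝ)) (p : P) :
    integralPairing P f p = ∫ x, f x ∂((p : ProbabilityMeasure X) : Measure X) :=
  rfl

lemma continuous_integralPairing (P : Set (ProbabilityMeasure X)) [CompactSpace P] :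
    Continuous (integralPairing P) := by
  refine AddMonoidHomClass.continuous_of_bound (integralPairing P) 1 fun f => ?_
  rw [one_mul, ContinuousMap.norm_le _ (norm_nonneg f)]
  intro p
  have := norm_integral_le_of_norm_le_const
    (μ := ((p : ProbabilityMeasure X) : Measure X)) (.of_forall f.norm_coe_le_norm)
  simpa using this

end Measures

/-- Universal approximation theorem on compact sets of Borel probability
measures on a compact metric space: functions of the form
`p ↦ ∑ i, α i * σ (b i + ∑ j, w i j * ∫ f_{i,j} dp)` with `f_{i,j}` in a dense
subset `M` of `C(X, ℝ)` are dense in `C(P, ℝ)`. -/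
theorem universal_approximation_measures
    {X : Type*} [MetricSpace X] [CompactSpace X] [MeasurableSpace X] [BorelSpace X]
    (M : Set C(X, ℝ)) (hM : Dense M)
    (σ : ℝ → ℝ) (hσc : Continuous σ)
    (hσp : ¬ ∃ q : Polynomial ℝ, ∀ t : ℝ, σ t = q.eval t)
    (P : Set (ProbabilityMeasure X)) (hP : IsCompact P) :
    ∀ (G : C(P, ℝ)) (ε : ℝ), 0 < ε →
      ∃ (d : ℕ) (m : Fin d → ℕ) (α b : Fin d → ℝ)
        (w : ∀ i : Fin d, Fin (m i) → ℝ) (g : ∀ i : Fin d, Fin (m i) → C(X, ℝ)),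
        (∀ i j, g i j ∈ M) ∧
        ∀ p : P,
          |G p - ∑ i, α i * σ (b i + ∑ j, w i j *
              ∫ x, g i j x ∂((p : ProbabilityMeasure X) : Measure X))| < ε := by
  intro G ε hε
  have : CompactSpace P := isCompact_iff_compactSpace.1 hP
  let s : C(ℝ, ℝ) := ⟨σ, hσc⟩
  let R : C(X, ℝ) → C(P, ℝ) := fun f => s.comp (integralPairing P f)
  have hR : Continuous R :=
    (ContinuousMap.continuous_postcomp s).comp (continuous_integralPairing P)
  let S : Submodule ℝ C(P, ℝ) := (Submodule.span ℝ (R '' M)).topologicalClosure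
  have hS : IsClosed (S : Set C(P, ℝ)) := Submodule.isClosed_topologicalClosure _
  have hRS : ∀ f, R f ∈ S := fun f =>
    closure_mono Submodule.subset_span (image_closure_subset_closure_image hR ⟨f, hM f, rfl⟩)
  have htop : S = ⊤ := by
    refine ContinuousMap.eq_top_of_comp_mem hS s hσp (LinearMap.range (integralPairing P)) ?_ ?_ ?_
    · intro b
      refine ⟨ContinuousMap.const X b, ?_⟩
      ext p
      simp
    · intro p q hpq
      by_contra! hcon
      refine hpq (Subtype.ext (Subtype.ext (ext_of_forall_integral_eq_of_IsFiniteMeasure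
        (μ := ((p : ProbabilityMeasure X) : Measure X))
        (ν := ((q : ProbabilityMeasure X) : Measure X)) fun f => ?_)))
      exact hcon _ ⟨f.toContinuousMap, rfl⟩
    · rintro _ ⟨f, rfl⟩
      exact hRS f
  have hG : G ∈ closure (Submodule.span ℝ (R '' M) : Set C(P, ℝ)) := by
    change G ∈ S
    rw [htop]
    trivial
  obtain ⟨H, hH, hGH⟩ := Metric.mem_closure_iff.1 hG ε hε
  obtain ⟨d, α, r, rfl⟩ := Submodule.mem_span_set'.1 hH
  choose g hgM hg using fun i => (r i).2
  refine ⟨d, fun _ => 1, α, fun _ => 0, fun _ _ => 1, fun i _ => g i, fun i _ => hgM i,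
    fun p => ?_⟩
  have := (ContinuousMap.dist_apply_le_dist p).trans_lt hGH
  rw [Real.dist_eq] at this
  refine lt_of_eq_of_lt ?_ this
  congr 2
  rw [ContinuousMap.sum_apply]
  refine Finset.sum_congr rfl fun i _ => ?_
  rw [ContinuousMap.smul_apply, ← hg i]
  simp [R, s]
end

section
/- Let X be a compact subset of ℝⁿ, let P be a compact set of Borel probability measures on X (with the topology of weak convergence), and let F : P → ℝ be continuous. Then for every ε > 0 there exist d, m ∈ ℕ, continuous maps f_I : X → ℝ^m whose components are outputs of a one-hidden-layer neural network with a continuous non-polynomial activation σ, and a function f_B : ℝ^m → ℝ realized as a composition of one layer x ↦ σ(Wx + b) (applied componentwise) followed by an affine map, such that sup_{p ∈ P} |F(p) − f_B(∫_X f_I(x) dp(x))| < ε, where the integral is applied coordinatewise. -/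
open Finset MeasureTheory

open Polynomial in
/-- Every real polynomial is the derivative of a polynomial. -/
theorem Polynomial.exists_derivative_eq_s2 (q : ℝ[X]) : ∃ p : ℝ[X], derivative p = q := by
  induction q using Polynomial.induction_on' with
  | add p q hp hq =>
    obtain ⟨r, rfl⟩ := hp
    obtain ⟨s, rfl⟩ := hq
    exact ⟨r + s, derivative_add⟩
  | monomial n a =>
    refine ⟨monomial (n + 1) (a / (n + 1)), ?_⟩
    rw [derivative_monomial]
    simp [div_mul_cancel₀ a (Nat.cast_add_one_ne_zero n : (n : ℝ) + 1 ≠ 0)]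

open Polynomial in
/-- A smooth function with vanishing `n`-th derivative is a polynomial of degree `< n`. -/
theorem exists_degreeLT_of_iteratedDeriv_eq_zero (n : ℕ) :
    ∀ f : ℝ → ℝ, ContDiff ℝ (⊤ : ℕ∞) f → (∀ x, iteratedDeriv n f x = 0) →
      ∃ p ∈ degreeLT ℝ n, ∀ x, f x = p.eval x := by
  induction n with
  | zero => exact fun f _ h => ⟨0, zero_mem _, fun x => by simpa using h x⟩
  | succ n ih =>
    intro f hf h
    have hf' : ContDiff ℝ (⊤ : ℕ∞) (deriv f) := (contDiff_infty_iff_deriv.1 hf).2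
    obtain ⟨q, hq, hfq⟩ := ih (deriv f) hf' fun x => by
      rw [← iteratedDeriv_succ']; exact h x
    obtain ⟨p, hp⟩ := q.exists_derivative_eq_s2
    have hd : Differentiable ℝ f := hf.differentiable (by simp)
    have hconst := is_const_of_deriv_eq_zero (f := fun x => f x - p.eval x)
      (hd.sub p.differentiable) fun x => by
        rw [deriv_fun_sub (hd x) p.differentiableAt, hfq, Polynomial.deriv, hp, sub_self]
    refine ⟨p + C (f 0 - p.eval 0), ?_, fun x => ?_⟩
    · rw [mem_degreeLT] at hq ⊢
      refine lt_of_le_of_lt degree_le_natDegree ?_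
      rw [natDegree_add_C]
      norm_cast
      by_cases h0 : p.natDegree = 0
      · omega
      · rw [← hp, degree_derivative h0] at hq
        norm_cast at hq
        omega
    · have := hconst x 0
      simp only [eval_add, eval_C]
      linarith

open Filter Topology in
/-- For a continuous non-polynomial function and every `n`, some mollification of it has a
nonvanishing `n`-th derivative. -/
theorem exists_iteratedDeriv_convolution_ne_zero {σ : ℝ → ℝ} (hσc : Continuous σ)
    (hσp : ¬ ∃ q : Polynomial ℝ, ∀ t : ℝ, σ t = q.eval t) (n : ℕ) :
    ∃ (φ : ContDiffBump (0 : ℝ)) (x : ℝ), iteratedDeriv n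
      (convolution (φ.normed volume) σ (ContinuousLinearMap.lsmul ℝ ℝ) volume) x ≠ 0 := by
  by_contra! h
  apply hσp
  let φ : ℕ → ContDiffBump (0 : ℝ) := fun k =>
    ⟨1 / (k + 1 : ℝ) / 2, 1 / (k + 1 : ℝ), by positivity, half_lt_self (by positivity)⟩
  have hlim : Tendsto (fun k => convolution ((φ k).normed volume) σ
      (ContinuousLinearMap.lsmul ℝ ℝ) volume) atTop (𝓝 σ) :=
    tendsto_pi_nhds.2 <| ContDiffBump.convolution_tendsto_right_of_continuous
      tendsto_one_div_add_atTop_nhds_zero_nat hσc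
  let ev : Polynomial ℝ →ₗ[ℝ] (ℝ → ℝ) := LinearMap.pi fun x => Polynomial.leval x
  have hmem := ((Polynomial.degreeLT ℝ n).map ev).closed_of_finiteDimensional.mem_of_tendsto hlim
    (Eventually.of_forall fun k => by
      obtain ⟨p, hp, hpe⟩ := exists_degreeLT_of_iteratedDeriv_eq_zero n _
        ((φ k).hasCompactSupport_normed.contDiff_convolution_left _ (φ k).contDiff_normed
          hσc.locallyIntegrable) (h (φ k))
      exact ⟨p, hp, funext fun x => (hpe x).symm⟩)
  obtain ⟨p, -, hp⟩ := hmem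
  exact ⟨p, fun t => (congrFun hp t).symm⟩

/-- A closed submodule contains the integrals of the functions with values in it. -/
theorem Submodule.integral_mem_of_isClosed {α E : Type*} [MeasurableSpace α] {μ : Measure α}
    [NormedAddCommGroup E] [NormedSpace ℝ E] [CompleteSpace E] (V : Submodule ℝ E)
    (hV : IsClosed (V : Set E)) {f : α → E} (hf : ∀ t, f t ∈ V) : ∫ t, f t ∂μ ∈ V := by
  have : CompleteSpace V := hV.completeSpace_coe
  have h := V.subtypeₗᵢ.integral_comp_comm (μ := μ) fun t => (⟨f t, hf t⟩ : V)
  have h' : ∫ t, f t ∂μ = V.subtypeₗᵢ (∫ t, (⟨f t, hf t⟩ : V) ∂μ) := h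
  rw [h']
  exact Subtype.coe_prop _

/-- A closed submodule contains the derivatives of the curves with values in it. -/
theorem Submodule.hasDerivAt_mem_of_isClosed {E : Type*} [NormedAddCommGroup E] [NormedSpace ℝ E]
    (V : Submodule ℝ E) (hV : IsClosed (V : Set E)) {g : ℝ → E} {g' : E} {a : ℝ}
    (h : HasDerivAt g g' a) (hg : ∀ a, g a ∈ V) : g' ∈ V :=
  hV.mem_of_tendsto (hasDerivAt_iff_tendsto_slope.1 h) <| Filter.Eventually.of_forall fun c =>
    V.smul_mem _ (V.sub_mem (hg c) (hg a))

section Compact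

variable {Y : Type*} [TopologicalSpace Y] [CompactSpace Y]

/-- A continuous curve in `C(Y, ℝ)` whose pointwise derivative is a continuous curve in `C(Y, ℝ)`
is differentiable for the supremum norm. -/
theorem ContinuousMap.hasDerivAt_of_eval {g g' : ℝ → C(Y, ℝ)} (hg' : Continuous g')
    (h : ∀ a y, HasDerivAt (fun a => g a y) (g' a y) a) (a : ℝ) : HasDerivAt g (g' a) a := by
  have heq : g = fun a => g 0 + ∫ s in (0 : ℝ)..a, g' s := by
    ext a y
    have h1 : (∫ s in (0 : ℝ)..a, g' s) y = ∫ s in (0 : ℝ)..a, g' s y :=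
      ((ContinuousMap.evalCLM ℝ y).intervalIntegral_comp_comm
        (hg'.intervalIntegrable 0 a)).symm
    have hc : Continuous fun s => g' s y := (ContinuousMap.evalCLM ℝ y).continuous.comp hg'
    rw [ContinuousMap.add_apply, h1, intervalIntegral.integral_eq_sub_of_hasDerivAt
      (fun s _ => h s y) (hc.intervalIntegrable 0 a)]
    ring
  rw [heq]
  exact (intervalIntegral.integral_hasDerivAt_right (hg'.intervalIntegrable 0 a)
    (hg'.stronglyMeasurableAtFilter _ _) hg'.continuousAt).const_add _

/-- If a closed subspace contains all dilates and translates `f (a * ℓ + b)` of a smooth function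
`f` of `ℓ`, then it contains all `ℓ ^ n * f⁽ⁿ⁾ (a * ℓ + b)`. -/
theorem pow_mul_iteratedDeriv_comp_mem {V : Submodule ℝ C(Y, ℝ)}
    (hV : IsClosed (V : Set C(Y, ℝ))) (ℓ : C(Y, ℝ)) {f : ℝ → ℝ} (hf : ContDiff ℝ (⊤ : ℕ∞) f)
    (hfV : ∀ (a b : ℝ) (g : C(Y, ℝ)), (∀ y, g y = f (a * ℓ y + b)) → g ∈ V) (n : ℕ) :
    ∀ (a b : ℝ) (g : C(Y, ℝ)),
      (∀ y, g y = ℓ y ^ n * iteratedDeriv n f (a * ℓ y + b)) → g ∈ V := by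
  have hcont : ∀ m, Continuous (iteratedDeriv m f) := fun m =>
    hf.continuous_iteratedDeriv m (by exact_mod_cast le_top)
  induction n with
  | zero => simpa using hfV
  | succ n ih =>
    intro a b g hg
    let G : ℕ → ℝ → C(Y, ℝ) := fun m => ContinuousMap.curry
      ⟨fun p : ℝ × Y => ℓ p.2 ^ m * iteratedDeriv m f (p.1 * ℓ p.2 + b), by
        have := hcont m
        fun_prop⟩
    have hG : ∀ m s y, G m s y = ℓ y ^ m * iteratedDeriv m f (s * ℓ y + b) := fun _ _ _ => rfl
    have hgG : g = G (n + 1) a := by ext y; rw [hg, hG]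
    rw [hgG]
    refine V.hasDerivAt_mem_of_isClosed hV (g := G n) (a := a)
      (ContinuousMap.hasDerivAt_of_eval (g' := G (n + 1)) (ContinuousMap.continuous _) ?_ a)
      fun s => ih s b _ (hG n s)
    intro s y
    simp only [hG]
    have hd : HasDerivAt (iteratedDeriv n f) (iteratedDeriv (n + 1) f (s * ℓ y + b))
        (s * ℓ y + b) := by
      rw [iteratedDeriv_succ]
      exact (hf.differentiable_iteratedDeriv n
        (by exact_mod_cast ENat.natCast_lt_top n)).differentiableAt.hasDerivAt
    have hlin : HasDerivAt (fun s => s * ℓ y + b) (1 * ℓ y) s :=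
      ((hasDerivAt_id s).mul_const _).add_const b
    exact ((hd.comp s hlin).const_mul (ℓ y ^ n)).congr_deriv (by ring)

/-- If a closed subspace contains all `σ (a * ℓ + b)`, where `σ` is continuous and not a
polynomial, then it contains all powers of `ℓ`. -/
theorem pow_mem_of_comp_mem {σ : ℝ → ℝ} (hσc : Continuous σ)
    (hσp : ¬ ∃ q : Polynomial ℝ, ∀ t : ℝ, σ t = q.eval t) {V : Submodule ℝ C(Y, ℝ)}
    (hV : IsClosed (V : Set C(Y, ℝ))) (ℓ : C(Y, ℝ))
    (hσV : ∀ (a b : ℝ) (g : C(Y, ℝ)), (∀ y, g y = σ (a * ℓ y + b)) → g ∈ V) (n : ℕ) :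
    ℓ ^ n ∈ V := by
  obtain ⟨φ, x, hx⟩ := exists_iteratedDeriv_convolution_ne_zero hσc hσp n
  set f := convolution (φ.normed volume) σ (ContinuousLinearMap.lsmul ℝ ℝ) volume with hf
  have hfs : ContDiff ℝ (⊤ : ℕ∞) f :=
    φ.hasCompactSupport_normed.contDiff_convolution_left _ φ.contDiff_normed hσc.locallyIntegrable
  have hfV : ∀ (a b : ℝ) (g : C(Y, ℝ)), (∀ y, g y = f (a * ℓ y + b)) → g ∈ V := by
    intro a b g hg
    let S : C(ℝ, C(Y, ℝ)) := ContinuousMap.curry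
      ⟨fun p : ℝ × Y => σ (a * ℓ p.2 + b - p.1), by fun_prop⟩
    have hS : ∀ t y, S t y = σ (a * ℓ y + b - t) := fun _ _ => rfl
    have hint : Integrable (fun t => φ.normed volume t • S t) :=
      (φ.continuous_normed.smul S.continuous).integrable_of_hasCompactSupport
        φ.hasCompactSupport_normed.smul_right
    have hgS : g = ∫ t, φ.normed volume t • S t := by
      ext y
      rw [ContinuousMap.integral_apply hint, hg, hf, convolution_def]
      rfl
    rw [hgS]
    refine V.integral_mem_of_isClosed hV fun t => V.smul_mem _ (hσV a (b - t) _ fun y => ?_)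
    rw [hS, add_sub_assoc]
  have hmem := pow_mul_iteratedDeriv_comp_mem hV ℓ hfs hfV n 0 x
    (iteratedDeriv n f x • ℓ ^ n) fun y => by simp [mul_comm]
  exact (V.smul_mem_iff hx).1 hmem

/-- Universal approximation: if a linear space `L` of continuous functions on a compact space
separates points and `σ` is continuous and not a polynomial, then the functions `σ (ℓ + b)` span
a dense subspace. -/
theorem topologicalClosure_span_comp_eq_top {σ : ℝ → ℝ} (hσc : Continuous σ)
    (hσp : ¬ ∃ q : Polynomial ℝ, ∀ t : ℝ, σ t = q.eval t) (L : Submodule ℝ C(Y, ℝ))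
    (hL : ∀ x y, x ≠ y → ∃ ℓ ∈ L, ℓ x ≠ ℓ y) :
    (Submodule.span ℝ {g : C(Y, ℝ) | ∃ ℓ ∈ L, ∃ b, ∀ y, g y = σ (ℓ y + b)}).topologicalClosure
      = ⊤ := by
  set V := (Submodule.span ℝ
    {g : C(Y, ℝ) | ∃ ℓ ∈ L, ∃ b, ∀ y, g y = σ (ℓ y + b)}).topologicalClosure
  have hV : IsClosed (V : Set C(Y, ℝ)) := Submodule.isClosed_topologicalClosure _
  have hpow : ∀ ℓ ∈ L, ∀ n : ℕ, ℓ ^ n ∈ V := fun ℓ hℓ =>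
    pow_mem_of_comp_mem hσc hσp hV ℓ fun a b g hg => Submodule.le_topologicalClosure _ <|
      Submodule.subset_span ⟨a • ℓ, L.smul_mem a hℓ, b, hg⟩
  have hexp : ∀ ℓ ∈ L, NormedSpace.exp ℓ ∈ V := fun ℓ hℓ =>
    hV.mem_of_tendsto (NormedSpace.exp_series_hasSum_exp' (𝕂 := ℝ) ℓ) <|
      Filter.Eventually.of_forall fun s => V.sum_mem fun n _ => V.smul_mem _ (hpow ℓ hℓ n)
  let E : Submonoid C(Y, ℝ) :=
    { carrier := {g | ∃ ℓ ∈ L, g = NormedSpace.exp ℓ}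
      one_mem' := ⟨0, L.zero_mem, NormedSpace.exp_zero.symm⟩
      mul_mem' := by
        rintro _ _ ⟨ℓ, hℓ, rfl⟩ ⟨k, hk, rfl⟩
        exact ⟨ℓ + k, L.add_mem hℓ hk, NormedSpace.exp_add.symm⟩ }
  have hEV : Subalgebra.toSubmodule (Algebra.adjoin ℝ (E : Set C(Y, ℝ))) ≤ V := by
    rw [Algebra.adjoin_eq_span, Submonoid.closure_eq, Submodule.span_le]
    rintro _ ⟨ℓ, hℓ, rfl⟩
    exact hexp ℓ hℓ
  have hsep : (Algebra.adjoin ℝ (E : Set C(Y, ℝ))).SeparatesPoints := by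
    intro x y hxy
    obtain ⟨ℓ, hℓ, hne⟩ := hL x y hxy
    have hev : ∀ z, (NormedSpace.exp ℓ : C(Y, ℝ)) z = Real.exp (ℓ z) := fun z => by
      rw [Real.exp_eq_exp_ℝ]
      exact NormedSpace.map_exp (ContinuousMap.evalAlgHom ℝ ℝ z)
        (ContinuousMap.evalCLM ℝ z).continuous ℓ
    refine ⟨_, ⟨NormedSpace.exp ℓ, Algebra.subset_adjoin ⟨ℓ, hℓ, rfl⟩, rfl⟩, ?_⟩
    simpa only [hev] using Real.exp_injective.ne hne
  have htop := ContinuousMap.subalgebra_topologicalClosure_eq_top_of_separatesPoints _ hsep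
  rw [eq_top_iff]
  intro g _
  have hg : g ∈ (Algebra.adjoin ℝ (E : Set C(Y, ℝ))).topologicalClosure := htop ▸ Algebra.mem_top
  exact closure_minimal hEV hV hg

end Compact

/-- Continuous functions on a compact space are integrable for finite measures. -/
theorem ContinuousMap.integrable_of_compactSpace {Y : Type*} [TopologicalSpace Y] [CompactSpace Y]
    [MeasurableSpace Y] [OpensMeasurableSpace Y] (μ : Measure Y) [IsFiniteMeasure μ] (f : C(Y, ℝ)) :
    Integrable f μ :=
  f.continuous.integrable_of_hasCompactSupport (HasCompactSupport.of_compactSpace f)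

/-- Integration against a probability measure is continuous for the supremum norm. -/
theorem ContinuousMap.continuous_integral {Y : Type*} [TopologicalSpace Y] [CompactSpace Y]
    [MeasurableSpace Y] [OpensMeasurableSpace Y] (μ : Measure Y) [IsProbabilityMeasure μ] :
    Continuous fun f : C(Y, ℝ) => ∫ y, f y ∂μ := by
  refine LipschitzWith.continuous (K := 1) (LipschitzWith.of_dist_le_mul fun f g => ?_)
  rw [dist_eq_norm, ← integral_sub (f.integrable_of_compactSpace μ) (g.integrable_of_compactSpace μ)]
  refine (norm_integral_le_of_norm_le_const (C := dist f g) (Filter.Eventually.of_forall fun y =>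
    (dist_eq_norm (f y) (g y)).symm.trans_le (ContinuousMap.dist_apply_le_dist y))).trans ?_
  simp

/-- Elements of the span of a set are linear combinations indexed by some `Fin d`. -/
theorem exists_fin_sum_of_mem_span {E : Type*} [AddCommGroup E] [Module ℝ E] {s : Set E} {g : E}
    (hg : g ∈ Submodule.span ℝ s) :
    ∃ (d : ℕ) (α : Fin d → ℝ) (e : Fin d → E), (∀ i, e i ∈ s) ∧ g = ∑ i, α i • e i := by
  obtain ⟨d, α, e, h⟩ := Submodule.mem_span_set'.1 hg
  exact ⟨d, α, fun i => e i, fun i => (e i).2, h.symm⟩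

/-- Any continuous real-valued function on a compact set of Borel probability
measures on a compact subset `K ⊆ ℝⁿ` can be approximated arbitrarily well by a
bag model `p ↦ f_B (∫ f_I dp)`, where the components of the instance model
`f_I : K → ℝᵐ` are outputs of one-hidden-layer neural networks with a continuous
non-polynomial activation `σ`, the aggregation is the coordinatewise integral
(mean), and the bag mapping `f_B` is one `σ`-layer followed by an affine map. -/
theorem bag_model_approximation
    (n : ℕ) (K : Set (Fin n → ℝ)) (hK : IsCompact K)
    (σ : ℝ → ℝ) (hσc : Continuous σ)
    (hσp : ¬ ∃ q : Polynomial ℝ, ∀ t : ℝ, σ t = q.eval t)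
    (P : Set (ProbabilityMeasure K)) (hP : IsCompact P)
    (F : ProbabilityMeasure K → ℝ) (hF : ContinuousOn F P)
    (ε : ℝ) (hε : 0 < ε) :
    ∃ (m : ℕ) (fI : K → Fin m → ℝ)
      (d : Fin m → ℕ) (α : ∀ t, Fin (d t) → ℝ) (b : ∀ t, Fin (d t) → ℝ)
      (w : ∀ t, Fin (d t) → Fin n → ℝ)
      (m' : ℕ) (W : Fin m' → Fin m → ℝ) (b' : Fin m' → ℝ) (u : Fin m' → ℝ) (c : ℝ),
      Continuous fI ∧
      (∀ (x : K) (t : Fin m),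
        fI x t = ∑ i, α t i * σ (b t i + ∑ j, w t i j * (x : Fin n → ℝ) j)) ∧
      ∀ p ∈ P,
        |F p - ((∑ s, u s * σ ((∑ t, W s t * ∫ x, fI x t ∂(p : Measure K)) + b' s)) + c)|
          < ε := by
  have : CompactSpace K := isCompact_iff_compactSpace.1 hK
  have : CompactSpace P := isCompact_iff_compactSpace.1 hP
  let lin : (Fin n → ℝ) →ₗ[ℝ] C(K, ℝ) :=
    { toFun := fun v => ⟨fun x => ∑ j, v j * (x : Fin n → ℝ) j,
        continuous_finsetSum _ fun j _ => continuous_const.mul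
          ((continuous_apply j).comp continuous_subtype_val)⟩
      map_add' := fun v v' => by ext x; simp [add_mul, Finset.sum_add_distrib]
      map_smul' := fun r v => by ext x; simp [mul_assoc, Finset.mul_sum] }
  set N := Submodule.span ℝ
    {g : C(K, ℝ) | ∃ ℓ ∈ LinearMap.range lin, ∃ b, ∀ y, g y = σ (ℓ y + b)}
  have hNtop : N.topologicalClosure = ⊤ := by
    refine topologicalClosure_span_comp_eq_top hσc hσp _ fun x y hxy => ?_
    obtain ⟨j, hj⟩ := Function.ne_iff.1 (Subtype.coe_injective.ne hxy)
    exact ⟨lin (Pi.single j 1), ⟨_, rfl⟩, by simpa [lin, Pi.single_apply] using hj⟩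
  let mean : C(K, ℝ) →ₗ[ℝ] C(P, ℝ) :=
    { toFun := fun f => ⟨fun p => ∫ x, f x ∂((p : ProbabilityMeasure K) : Measure K),
        (ProbabilityMeasure.continuous_integral_boundedContinuousFunction
          (BoundedContinuousFunction.mkOfCompact f)).comp continuous_subtype_val⟩
      map_add' := fun f g => by
        ext p
        exact integral_add (f.integrable_of_compactSpace _) (g.integrable_of_compactSpace _)
      map_smul' := fun r f => by ext p; exact integral_const_mul r f }
  have htop := topologicalClosure_span_comp_eq_top hσc hσp (N.map mean) fun p q hpq => by
    by_contra! h
    refine hpq (Subtype.ext (Subtype.ext (ext_of_forall_integral_eq_of_IsFiniteMeasure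
      (μ := (p.1 : Measure K)) (ν := (q.1 : Measure K)) fun f => ?_)))
    have hclosed : IsClosed {g : C(K, ℝ) | ∫ x, g x ∂((p : ProbabilityMeasure K) : Measure K)
        = ∫ x, g x ∂((q : ProbabilityMeasure K) : Measure K)} :=
      isClosed_eq (ContinuousMap.continuous_integral _) (ContinuousMap.continuous_integral _)
    have hf : f.toContinuousMap ∈ N.topologicalClosure := hNtop ▸ Submodule.mem_top
    exact closure_minimal (fun g hg => h (mean g) ⟨g, hg, rfl⟩) hclosed hf
  let F' : C(P, ℝ) := ⟨P.domRestrict F, hF.domRestrict⟩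
  have hF' : F' ∈ closure (_ : Set C(P, ℝ)) := (Submodule.eq_top_iff'.1 htop F' :)
  obtain ⟨g, hg, hdist⟩ := Metric.mem_closure_iff.1 hF' ε hε
  obtain ⟨m, u, e, he, rfl⟩ := exists_fin_sum_of_mem_span hg
  choose ℓ hℓ b' hb' using he
  choose f hf hfℓ using hℓ
  choose d α a ha hfa using fun t => exists_fin_sum_of_mem_span (hf t)
  choose k hk b hb using ha
  choose w hw using hk
  refine ⟨m, fun x t => f t x, d, α, b, w, m, fun s t => if s = t then 1 else 0, b', u, 0,
    by fun_prop, fun x t => ?_, fun p hp => ?_⟩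
  · simp only [hfa t, ContinuousMap.coe_sum, Finset.sum_apply, ContinuousMap.coe_smul,
      Pi.smul_apply, smul_eq_mul]
    refine Finset.sum_congr rfl fun i _ => ?_
    rw [hb, ← hw, add_comm]
    rfl
  · have h := lt_of_le_of_lt (ContinuousMap.dist_apply_le_dist ⟨p, hp⟩) hdist
    rw [Real.dist_eq] at h
    have hsum : (∑ i, u i • e i) ⟨p, hp⟩
        = ∑ i, u i * σ (∫ x, f i x ∂(p : Measure K) + b' i) := by
      simp only [ContinuousMap.coe_sum, Finset.sum_apply, ContinuousMap.coe_smul,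
        Pi.smul_apply, smul_eq_mul, hb', ← hfℓ]
      rfl
    rw [hsum] at h
    change |F p - _| < ε at h
    simpa using h
end

section
/- Let X_1, …, X_l be compact metric spaces, and for each i let M_i be a set of continuous real-valued functions on X_i that is dense in C(X_i) with respect to the supremum norm. Let σ : ℝ → ℝ be continuous and not an algebraic polynomial. Then the set of functions f : X_1 × ⋯ × X_l → ℝ of the form f(x_1, …, x_l) = Σ_{i=1}^{d} α_i · σ(b_i + Σ_{j=1}^{l} w_{i,j} f_{i,j}(x_j)), where d ∈ ℕ, α_i, b_i, w_{i,j} ∈ ℝ and f_{i,j} ∈ M_j, is dense in C(X_1 × ⋯ × X_l) with respect to the supremum norm, where the product space carries the product topology. -/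
open Finset

open scoped ContDiff Convolution Topology

/-- A smooth function whose `n`-th derivative vanishes is a combination of `1, t, …, t ^ (n - 1)`. -/
theorem eq_sum_pow_of_iteratedDeriv_eq_zero (n : ℕ) (f : ℝ → ℝ) (hf : ContDiff ℝ ∞ f)
    (h : ∀ t, iteratedDeriv n f t = 0) :
    ∃ c : ℕ → ℝ, ∀ t, f t = ∑ i ∈ range n, c i * t ^ i := by
  induction n generalizing f with
  | zero => exact ⟨0, fun t => by simpa using h t⟩
  | succ n ih =>
    have hf' : ContDiff ℝ ∞ (deriv f) := (contDiff_infty_iff_deriv.1 hf).2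
    obtain ⟨c, hc⟩ := ih (deriv f) hf' fun t => by rw [← iteratedDeriv_succ']; exact h t
    refine ⟨fun i => if i = 0 then f 0 else c (i - 1) / i, fun t => ?_⟩
    have hd : ∀ x, HasDerivAt (fun y => f y - ∑ i ∈ range n, c i / (i + 1) * y ^ (i + 1)) 0 x := by
      intro x
      have h1 : HasDerivAt f (deriv f x) x :=
        (hf.differentiable (by simp)).differentiableAt.hasDerivAt
      have h2 : HasDerivAt (fun y : ℝ => ∑ i ∈ range n, c i / (i + 1) * y ^ (i + 1))
          (∑ i ∈ range n, c i * x ^ i) x := by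
        refine HasDerivAt.fun_sum fun i _ => ?_
        have hi : (i : ℝ) + 1 ≠ 0 := by positivity
        have hp : c i / (i + 1) * (((i + 1 : ℕ) : ℝ) * x ^ i) = c i * x ^ i := by
          push_cast
          field_simp
        exact hp ▸ (hasDerivAt_pow (i + 1) x).const_mul (c i / (i + 1))
      have h3 := h1.fun_sub h2
      rwa [hc x, sub_self] at h3
    have := is_const_of_deriv_eq_zero (fun x => (hd x).differentiableAt) (fun x => (hd x).deriv) t 0
    rw [sum_range_succ']
    simp at this ⊢
    linarith

/-- If every mollification of a continuous function has vanishing `n`-th derivative, the function is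
a polynomial. -/
theorem exists_polynomial_of_iteratedDeriv_convolution_eq_zero (n : ℕ) (σ : ℝ → ℝ)
    (hσ : Continuous σ)
    (h : ∀ φ : ContDiffBump (0 : ℝ), ∀ t,
      iteratedDeriv n (φ.normed MeasureTheory.volume
        ⋆[ContinuousLinearMap.lsmul ℝ ℝ, MeasureTheory.volume] σ) t = 0) :
    ∃ q : Polynomial ℝ, ∀ t, σ t = q.eval t := by
  let S : Submodule ℝ (ℝ → ℝ) :=
    Submodule.span ℝ (Set.range fun i : Fin n => fun t : ℝ => t ^ (i : ℕ))
  have : FiniteDimensional ℝ S := FiniteDimensional.span_of_finite ℝ (Set.finite_range _)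
  have hS : IsClosed (S : Set (ℝ → ℝ)) := S.closed_of_finiteDimensional
  have hmem : ∀ φ : ContDiffBump (0 : ℝ), (φ.normed MeasureTheory.volume
      ⋆[ContinuousLinearMap.lsmul ℝ ℝ, MeasureTheory.volume] σ) ∈ S := by
    intro φ
    obtain ⟨c, hc⟩ := eq_sum_pow_of_iteratedDeriv_eq_zero n _
      (φ.hasCompactSupport_normed.contDiff_convolution_left _ φ.contDiff_normed
        hσ.locallyIntegrable) (h φ)
    have : (φ.normed MeasureTheory.volume
        ⋆[ContinuousLinearMap.lsmul ℝ ℝ, MeasureTheory.volume] σ)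
        = ∑ i : Fin n, c i • fun t : ℝ => t ^ (i : ℕ) := by
      ext t
      rw [hc t, Finset.sum_range]
      simp
    rw [this]
    exact S.sum_mem fun i _ => S.smul_mem _ (Submodule.subset_span ⟨i, rfl⟩)
  let φ : ℕ → ContDiffBump (0 : ℝ) := fun k =>
    ⟨1 / ((k : ℝ) + 1) / 2, 1 / ((k : ℝ) + 1), by positivity, half_lt_self (by positivity)⟩
  have hlim : Filter.Tendsto (fun k => ((φ k).normed MeasureTheory.volume
      ⋆[ContinuousLinearMap.lsmul ℝ ℝ, MeasureTheory.volume] σ)) Filter.atTop (𝓝 σ) :=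
    tendsto_pi_nhds.2 fun t =>
      ContDiffBump.convolution_tendsto_right_of_continuous
        tendsto_one_div_add_atTop_nhds_zero_nat hσ t
  have hσS : σ ∈ S := hS.mem_of_tendsto hlim (Filter.Eventually.of_forall fun k => hmem _)
  obtain ⟨c, hc⟩ := (Submodule.mem_span_range_iff_exists_fun ℝ).1 hσS
  refine ⟨∑ i, Polynomial.C (c i) * Polynomial.X ^ (i : ℕ), fun t => ?_⟩
  rw [← hc, Polynomial.eval_finsetSum]
  simp

section

variable {K : Type*} [TopologicalSpace K]

/-- The function `x ↦ f (w * h x + b)`. -/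
def affineComp (f : C(ℝ, ℝ)) (h : C(K, ℝ)) (w b : ℝ) : C(K, ℝ) :=
  f.comp (w • h + ContinuousMap.const K b)

@[simp]
theorem affineComp_apply (f : C(ℝ, ℝ)) (h : C(K, ℝ)) (w b : ℝ) (x : K) :
    affineComp f h w b x = f (w * h x + b) := rfl

theorem continuous_affineComp_sub (f : C(ℝ, ℝ)) (h : C(K, ℝ)) (w b : ℝ) :
    Continuous fun s => affineComp f h w (b - s) := by
  refine ContinuousMap.continuous_of_continuous_uncurry _ ?_
  change Continuous fun p : ℝ × K => f (w * h p.2 + (b - p.1))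
  fun_prop

/-- Integrals of families with values in a closed subspace stay in it. -/
theorem integral_mem_of_isClosed {E : Type*} [NormedAddCommGroup E] [NormedSpace ℝ E]
    [CompleteSpace E] (V : Submodule ℝ E) (hV : IsClosed (V : Set E)) (F : ℝ → E)
    (hF : MeasureTheory.Integrable F) (hFV : ∀ s, F s ∈ V) : ∫ s, F s ∈ V := by
  by_contra hn
  obtain ⟨L, u, hL, hu⟩ := geometric_hahn_banach_closed_point V.convex hV hn
  have h0 : ∀ v ∈ V, L v = 0 := by
    intro v hv
    by_contra hne
    have := hL ((u / L v) • v) (V.smul_mem _ hv)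
    rw [map_smul, smul_eq_mul, div_mul_cancel₀ _ hne] at this
    exact lt_irrefl _ this
  have hu0 : 0 < u := by simpa using hL 0 V.zero_mem
  rw [← L.integral_comp_comm hF] at hu
  simp only [h0 _ (hFV _), MeasureTheory.integral_zero] at hu
  linarith

variable [CompactSpace K]

/-- A closed subspace containing all `σ (w * h + b)` contains the same for mollified `σ`. -/
theorem affineComp_convolution_mem (V : Submodule ℝ C(K, ℝ)) (hV : IsClosed (V : Set C(K, ℝ)))
    (σ : C(ℝ, ℝ)) (h : C(K, ℝ)) (hσ : ∀ w b, affineComp σ h w b ∈ V)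
    (φ : ContDiffBump (0 : ℝ)) (f : C(ℝ, ℝ))
    (hf : ∀ t, f t = (φ.normed MeasureTheory.volume
        ⋆[ContinuousLinearMap.lsmul ℝ ℝ, MeasureTheory.volume] σ) t) (w b : ℝ) :
    affineComp f h w b ∈ V := by
  let F : ℝ → C(K, ℝ) := fun s => φ.normed MeasureTheory.volume s • affineComp σ h w (b - s)
  have hF : MeasureTheory.Integrable F := by
    refine Continuous.integrable_of_hasCompactSupport
      (φ.continuous_normed.smul (continuous_affineComp_sub σ h w b)) ?_
    exact φ.hasCompactSupport_normed.smul_right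
  have : affineComp f h w b = ∫ s, F s := by
    ext x
    have := (ContinuousMap.evalCLM ℝ x : C(K, ℝ) →L[ℝ] ℝ).integral_comp_comm hF
    change _ = ContinuousMap.evalCLM ℝ x (∫ s, F s)
    rw [← this, affineComp_apply, hf, MeasureTheory.convolution]
    simp [F, add_sub_assoc]
  rw [this]
  exact integral_mem_of_isClosed V hV F hF fun s => V.smul_mem _ (hσ _ _)

/-- Differentiating `u * g (w * h + b)` in the parameter `w` stays in a closed subspace. -/
theorem mul_affineComp_deriv_mem (V : Submodule ℝ C(K, ℝ)) (hV : IsClosed (V : Set C(K, ℝ)))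
    (u h : C(K, ℝ)) (g g' : C(ℝ, ℝ)) (hg : ∀ t, HasDerivAt g (g' t) t)
    (hgV : ∀ w b, u * affineComp g h w b ∈ V) (w b : ℝ) :
    u * h * affineComp g' h w b ∈ V := by
  have hc : Continuous fun p : ℝ × K => ∫ s in (0 : ℝ)..1, g' ((w + p.1 * s) * h p.2 + b) := by
    apply intervalIntegral.continuous_parametric_intervalIntegral_of_continuous'
    change Continuous fun q : (ℝ × K) × ℝ => g' ((w + q.1.1 * q.2) * h q.1.2 + b)
    fun_prop
  let Φ : C(ℝ, C(K, ℝ)) := ContinuousMap.curry ⟨_, hc⟩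
  have hΦ : ∀ r x, Φ r x = ∫ s in (0 : ℝ)..1, g' ((w + r * s) * h x + b) := fun _ _ => rfl
  have hne : ∀ r ≠ 0, u * h * Φ r ∈ V := by
    intro r hr
    have : u * h * Φ r = r⁻¹ • (u * affineComp g h (w + r) b - u * affineComp g h w b) := by
      ext x
      have hd : ∀ s ∈ Set.uIcc (0 : ℝ) 1, HasDerivAt (fun s => g ((w + r * s) * h x + b))
          (g' ((w + r * s) * h x + b) * (r * h x)) s := by
        intro s _
        have h1 : HasDerivAt (fun s : ℝ => (w + r * s) * h x + b) (r * h x) s := by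
          simpa using ((((hasDerivAt_id s).const_mul r).const_add w).mul_const (h x)).add_const b
        exact (hg _).comp s h1
      have := intervalIntegral.integral_eq_sub_of_hasDerivAt hd
        (Continuous.intervalIntegrable (by fun_prop) _ _)
      rw [intervalIntegral.integral_mul_const, ← hΦ] at this
      simp only [mul_one, mul_zero, add_zero] at this
      simp only [ContinuousMap.mul_apply, ContinuousMap.smul_apply, ContinuousMap.sub_apply,
        affineComp_apply, smul_eq_mul]
      rw [← mul_sub, ← this]
      field_simp
    rw [this]
    exact V.smul_mem _ (V.sub_mem (hgV _ _) (hgV _ _))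
  have hcont : Continuous fun r => u * h * Φ r := by fun_prop
  have h0 : u * h * Φ 0 ∈ V := by
    have : Filter.Tendsto (fun r => u * h * Φ r) (𝓝[≠] 0) (𝓝 (u * h * Φ 0)) :=
      (hcont.tendsto 0).mono_left nhdsWithin_le_nhds
    exact hV.mem_of_tendsto this (by filter_upwards [self_mem_nhdsWithin] with r hr using hne r hr)
  convert h0 using 2
  ext x
  simp [hΦ]

theorem pow_mul_affineComp_iteratedDeriv_mem (V : Submodule ℝ C(K, ℝ))
    (hV : IsClosed (V : Set C(K, ℝ))) (h : C(K, ℝ)) (f : C(ℝ, ℝ)) (hf : ContDiff ℝ ∞ f)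
    (hfV : ∀ w b, affineComp f h w b ∈ V) (n : ℕ) (g : C(ℝ, ℝ))
    (hg : ∀ t, g t = iteratedDeriv n f t) (w b : ℝ) : h ^ n * affineComp g h w b ∈ V := by
  induction n generalizing g w b with
  | zero =>
    have : g = f := by ext t; simpa using hg t
    simpa [this] using hfV w b
  | succ n ih =>
    let g₀ : C(ℝ, ℝ) := ⟨iteratedDeriv n f, hf.continuous_iteratedDeriv n (by exact_mod_cast le_top)⟩
    rw [pow_succ]
    refine mul_affineComp_deriv_mem V hV (h ^ n) h g₀ g (fun t => ?_)
      (fun w b => ih g₀ (fun _ => rfl) w b) w b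
    rw [hg t, iteratedDeriv_succ]
    exact (hf.differentiable_iteratedDeriv n
      (by exact_mod_cast WithTop.coe_lt_top _)).differentiableAt.hasDerivAt

/-- A closed subspace containing all `σ (w * h + b)`, with `σ` not a polynomial, contains all powers
of `h`. -/
theorem pow_mem_of_affineComp_mem (V : Submodule ℝ C(K, ℝ)) (hV : IsClosed (V : Set C(K, ℝ)))
    (σ : C(ℝ, ℝ)) (hσp : ¬ ∃ q : Polynomial ℝ, ∀ t : ℝ, σ t = q.eval t) (h : C(K, ℝ))
    (hσ : ∀ w b, affineComp σ h w b ∈ V) (n : ℕ) : h ^ n ∈ V := by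
  have hex : ∃ φ : ContDiffBump (0 : ℝ), ∃ t,
      iteratedDeriv n (φ.normed MeasureTheory.volume
        ⋆[ContinuousLinearMap.lsmul ℝ ℝ, MeasureTheory.volume] σ) t ≠ 0 := by
    by_contra! hcon
    exact hσp (exists_polynomial_of_iteratedDeriv_convolution_eq_zero n σ σ.continuous hcon)
  obtain ⟨φ, b, hb⟩ := hex
  have hsm : ContDiff ℝ ∞ (φ.normed MeasureTheory.volume
      ⋆[ContinuousLinearMap.lsmul ℝ ℝ, MeasureTheory.volume] σ) :=
    φ.hasCompactSupport_normed.contDiff_convolution_left _ φ.contDiff_normed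
      σ.continuous.locallyIntegrable
  let f : C(ℝ, ℝ) := ⟨_, hsm.continuous⟩
  let g : C(ℝ, ℝ) := ⟨iteratedDeriv n f, hsm.continuous_iteratedDeriv n (by exact_mod_cast le_top)⟩
  have key := pow_mul_affineComp_iteratedDeriv_mem V hV h f hsm
    (affineComp_convolution_mem V hV σ h hσ φ f fun _ => rfl) n g (fun _ => rfl) 0 b
  have : h ^ n = (g b)⁻¹ • (h ^ n * affineComp g h 0 b) := by
    ext x
    have : g b ≠ 0 := hb
    simp
    field_simp
  rw [this]
  exact V.smul_mem _ key

/-- If a closed subspace contains all powers of all elements of a point-separating subspace `E`,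
it is everything. -/
theorem eq_top_of_forall_pow_mem (V E : Submodule ℝ C(K, ℝ)) (hV : IsClosed (V : Set C(K, ℝ)))
    (hE : ∀ x y : K, x ≠ y → ∃ h ∈ E, h x ≠ h y) (hpow : ∀ h ∈ E, ∀ n : ℕ, h ^ n ∈ V) :
    V = ⊤ := by
  let P : Submonoid C(K, ℝ) :=
    { carrier := NormedSpace.exp '' (E : Set C(K, ℝ))
      one_mem' := ⟨0, E.zero_mem, NormedSpace.exp_zero⟩
      mul_mem' := by
        rintro _ _ ⟨a, ha, rfl⟩ ⟨b, hb, rfl⟩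
        exact ⟨a + b, E.add_mem ha hb, NormedSpace.exp_add⟩ }
  have hexp : ∀ (h : C(K, ℝ)) (x : K), NormedSpace.exp h x = Real.exp (h x) := by
    intro h x
    have := NormedSpace.map_exp (ContinuousMap.evalAlgHom ℝ ℝ x)
      (continuous_eval_const x) h
    rw [Real.exp_eq_exp_ℝ]
    exact this
  let A : Subalgebra ℝ C(K, ℝ) := Algebra.adjoin ℝ (P : Set C(K, ℝ))
  have hA : A.SeparatesPoints := by
    intro x y hxy
    obtain ⟨h, hh, hne⟩ := hE x y hxy
    refine ⟨_, ⟨NormedSpace.exp h, Algebra.subset_adjoin ⟨h, hh, rfl⟩, rfl⟩, ?_⟩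
    simpa [hexp] using hne
  have hAV : Subalgebra.toSubmodule A ≤ V := by
    rw [Algebra.adjoin_eq_span, Submonoid.closure_eq, Submodule.span_le]
    rintro _ ⟨h, hh, rfl⟩
    exact hV.mem_of_tendsto (NormedSpace.exp_series_hasSum_exp' (𝕂 := ℝ) h)
      (Filter.Eventually.of_forall fun s => V.sum_mem fun n _ => V.smul_mem _ (hpow h hh n))
  have htop := ContinuousMap.subalgebra_topologicalClosure_eq_top_of_separatesPoints A hA
  rw [eq_top_iff]
  intro G _
  have hG : G ∈ A.topologicalClosure := htop ▸ Algebra.mem_top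
  exact closure_minimal hAV hV hG

end

/-- The function `x ↦ ∑ j, g j (x j)` on a product, linear in `g`. -/
def coordSum {ι : Type*} [Fintype ι] (X : ι → Type*) [∀ i, TopologicalSpace (X i)] :
    (∀ i, C(X i, ℝ)) →ₗ[ℝ] C((∀ i, X i), ℝ) where
  toFun g := ∑ j, (g j).comp ⟨fun x => x j, continuous_apply j⟩
  map_add' g g' := by ext x; simp [Finset.sum_add_distrib]
  map_smul' c g := by ext x; simp [Finset.mul_sum]

@[simp]
theorem coordSum_apply {ι : Type*} [Fintype ι] (X : ι → Type*) [∀ i, TopologicalSpace (X i)]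
    (g : ∀ i, C(X i, ℝ)) (x : ∀ i, X i) : coordSum X g x = ∑ j, g j (x j) := by
  simp [coordSum]

theorem continuous_coordSum {ι : Type*} [Fintype ι] (X : ι → Type*)
    [∀ i, TopologicalSpace (X i)] : Continuous (coordSum X) := by
  change Continuous fun g : ∀ i, C(X i, ℝ) =>
    ∑ j, (g j).comp (⟨fun x => x j, continuous_apply j⟩ : C((∀ i, X i), X j))
  exact continuous_finsetSum _ fun j _ =>
    (ContinuousMap.continuous_precomp _).comp (continuous_apply j)

/-- Universal approximation theorem for products of compact metric spaces:
functions of the form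
`x ↦ ∑ i, α i * σ (b i + ∑ j, w i j * f_{i,j} (x j))`, with `f_{i,j}` in a
dense subset `M j` of `C(X j, ℝ)`, are dense in `C(X₁ × ⋯ × X_l, ℝ)`. -/
theorem universal_approximation_product
    (l : ℕ) (X : Fin l → Type*) [∀ i, MetricSpace (X i)] [∀ i, CompactSpace (X i)]
    (M : ∀ i, Set C(X i, ℝ)) (hM : ∀ i, Dense (M i))
    (σ : ℝ → ℝ) (hσc : Continuous σ)
    (hσp : ¬ ∃ q : Polynomial ℝ, ∀ t : ℝ, σ t = q.eval t) :
    ∀ (G : C((∀ i, X i), ℝ)) (ε : ℝ), 0 < ε →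
      ∃ (d : ℕ) (α b : Fin d → ℝ) (w : Fin d → Fin l → ℝ)
        (g : Fin d → ∀ j, C(X j, ℝ)),
        (∀ i j, g i j ∈ M j) ∧
        ∀ x : ∀ i, X i, |G x - ∑ i, α i * σ (b i + ∑ j, w i j * g i j (x j))| < ε := by
  intro G ε hε
  let s : C(ℝ, ℝ) := ⟨σ, hσc⟩
  let N : Set C((∀ i, X i), ℝ) :=
    {F | ∃ (b : ℝ) (g : ∀ j, C(X j, ℝ)), (∀ j, g j ∈ M j) ∧ F = affineComp s (coordSum X g) 1 b}
  let V := (Submodule.span ℝ N).topologicalClosure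
  have hV : IsClosed (V : Set C((∀ i, X i), ℝ)) := Submodule.isClosed_topologicalClosure _
  have hmem : ∀ g b, affineComp s (coordSum X g) 1 b ∈ V := by
    intro g b
    have hd : Dense (Set.univ.pi M) := dense_pi _ fun i _ => hM i
    have hc : Continuous fun g => affineComp s (coordSum X g) 1 b := by
      refine (ContinuousMap.continuous_postcomp s).comp ?_
      exact ((continuous_coordSum X).const_smul (1 : ℝ)).add continuous_const
    have := hd.induction (P := fun g => affineComp s (coordSum X g) 1 b ∈ V)
      (fun g hg => Submodule.le_topologicalClosure _
        (Submodule.subset_span ⟨b, g, fun j => hg j (Set.mem_univ j), rfl⟩))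
      (hV.preimage hc)
    exact this g
  have htop : V = ⊤ := by
    refine eq_top_of_forall_pow_mem V (LinearMap.range (coordSum X)) hV ?_ ?_
    · intro x y hxy
      obtain ⟨j, hj⟩ := Function.ne_iff.1 hxy
      refine ⟨_, ⟨Pi.single j ⟨fun z => dist z (y j), by fun_prop⟩, rfl⟩, ?_⟩
      have : ∀ z : ∀ i, X i, coordSum X
          (Pi.single j ⟨fun z => dist z (y j), by fun_prop⟩) z = dist (z j) (y j) := by
        intro z
        rw [coordSum_apply, Finset.sum_eq_single j]
        · simp
        · intro i _ hi
          simp [Pi.single_eq_of_ne hi]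
        · simp
      rw [this, this]
      simpa using hj
    · rintro _ ⟨g, rfl⟩ n
      refine pow_mem_of_affineComp_mem V hV s hσp _ (fun w b => ?_) n
      have : affineComp s (coordSum X g) w b = affineComp s (coordSum X (w • g)) 1 b := by
        ext x
        simp [affineComp_apply, Finset.mul_sum]
      rw [this]
      exact hmem _ _
  have hG : G ∈ closure (Submodule.span ℝ N : Set C((∀ i, X i), ℝ)) := by
    have : G ∈ V := htop ▸ Submodule.mem_top
    exact this
  obtain ⟨F, hF, hGF⟩ := Metric.mem_closure_iff.1 hG ε hε
  obtain ⟨d, α, F', rfl⟩ := Submodule.mem_span_set'.1 hF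
  choose b g hg hF' using fun i => (F' i).2
  refine ⟨d, α, b, fun _ _ => 1, g, hg, fun x => ?_⟩
  refine lt_of_le_of_lt (le_of_eq ?_) ((ContinuousMap.dist_apply_le_dist x).trans_lt hGF)
  rw [Real.dist_eq, ContinuousMap.sum_apply]
  simp [hF', s, add_comm]
end

section
/- Let X be a set and let k : X × X → ℝ be a symmetric positive semidefinite kernel (i.e., for all n ∈ ℕ, all x_1, …, x_n ∈ X and all c_1, …, c_n ∈ ℝ, Σ_{i,j} c_i c_j k(x_i, x_j) ≥ 0). Then for every p ∈ ℕ with p ≥ 1, the multi-instance bag kernel K defined on nonempty finite subsets of X by K(b_1, b_2) = Σ_{x_1 ∈ b_1} Σ_{x_2 ∈ b_2} k(x_1, x_2)^p is itself a symmetric positive semidefinite kernel on the collection of nonempty finite subsets of X. -/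
open Finset

/-- A symmetric real kernel all of whose finite quadratic forms are nonnegative is a positive
semidefinite matrix. -/
theorem Matrix.posSemidef_of_forall_fin_sum_nonneg {X : Type*} {k : X → X → ℝ}
    (hsymm : ∀ x y, k x y = k y x)
    (hpsd : ∀ (n : ℕ) (x : Fin n → X) (c : Fin n → ℝ),
      0 ≤ ∑ i, ∑ j, c i * c j * k (x i) (x j)) :
    (Matrix.of k).PosSemidef := by
  refine ⟨Matrix.IsHermitian.ext fun x y ↦ by simp [hsymm x y], fun c ↦ ?_⟩
  have sum_eq (g : X → ℝ) : ∑ i, g (c.support.equivFin.symm i) = ∑ x ∈ c.support, g x := by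
    rw [c.support.equivFin.symm.sum_comp fun x ↦ g x, sum_coe_sort]
  have h := hpsd _ (fun i ↦ c.support.equivFin.symm i) fun i ↦ c (c.support.equivFin.symm i)
  refine h.trans_eq ?_
  rw [Finsupp.sum, ← sum_eq]
  refine sum_congr rfl fun i _ ↦ ?_
  rw [Finsupp.sum, ← sum_eq]
  simp [mul_right_comm]

/-- Positive entrywise powers of a real positive semidefinite matrix are positive semidefinite. -/
theorem Matrix.PosSemidef.map_pow {X : Type*} {M : Matrix X X ℝ} (hM : M.PosSemidef)
    {p : ℕ} (hp : 1 ≤ p) : (M.map (· ^ p)).PosSemidef := by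
  induction p, hp using Nat.le_induction with
  | base => simpa using hM
  | succ p _ ih =>
    have pow_succ_eq : M.map (· ^ (p + 1)) = (M.map (· ^ p)).hadamard M := by
      ext x y
      simp [pow_succ]
    exact pow_succ_eq ▸ ih.hadamard hM

/-- The quadratic form of the matrix of sums of `M` over pairs of finite sets is nonnegative. -/
theorem Matrix.PosSemidef.sum_sum_finset_nonneg {X ι : Type*} [Fintype ι] {M : Matrix X X ℝ}
    (hM : M.PosSemidef) (B : ι → Finset X) (c : ι → ℝ) :
    0 ≤ ∑ i, ∑ j, c i * c j * ∑ x ∈ B i, ∑ y ∈ B j, M x y := by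
  have h := (hM.submatrix fun s : Σ i, B i ↦ (s.2 : X)).dotProduct_mulVec_nonneg fun s ↦ c s.1
  simp only [dotProduct, Matrix.mulVec, Matrix.submatrix_apply, Pi.star_apply, star_trivial,
    Fintype.sum_sigma] at h
  refine h.trans_eq (sum_congr rfl fun i _ ↦ ?_)
  rw [sum_coe_sort (B i) fun x ↦ c i * ∑ j, ∑ y : B j, M x y * c j]
  simp only [mul_sum]
  rw [sum_comm]
  refine sum_congr rfl fun j _ ↦ sum_congr rfl fun x _ ↦ ?_
  rw [sum_coe_sort (B j) fun y ↦ c i * (M x y * c j)]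
  exact sum_congr rfl fun y _ ↦ by ring

/-- The multi-instance set kernel
`K(b₁, b₂) = ∑_{x₁ ∈ b₁} ∑_{x₂ ∈ b₂} k(x₁, x₂)^p` built from a symmetric
positive semidefinite instance kernel `k` is itself a symmetric positive
semidefinite kernel on the collection of nonempty finite bags. -/
theorem set_kernel_pos_semidef
    {X : Type*} (k : X → X → ℝ)
    (hsymm : ∀ x y, k x y = k y x)
    (hpsd : ∀ (n : ℕ) (x : Fin n → X) (c : Fin n → ℝ),
      0 ≤ ∑ i, ∑ j, c i * c j * k (x i) (x j))
    (p : ℕ) (hp : 1 ≤ p) :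
    (∀ b₁ b₂ : Finset X, b₁.Nonempty → b₂.Nonempty →
      (∑ x₁ ∈ b₁, ∑ x₂ ∈ b₂, k x₁ x₂ ^ p) = ∑ x₁ ∈ b₂, ∑ x₂ ∈ b₁, k x₁ x₂ ^ p) ∧
    (∀ (n : ℕ) (B : Fin n → Finset X), (∀ i, (B i).Nonempty) →
      ∀ c : Fin n → ℝ,
        0 ≤ ∑ i, ∑ j, c i * c j * (∑ x₁ ∈ B i, ∑ x₂ ∈ B j, k x₁ x₂ ^ p)) := by
  refine ⟨fun b₁ b₂ _ _ ↦ ?_, fun n B _ c ↦ ?_⟩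
  · rw [sum_comm]
    simp only [hsymm]
  · exact ((Matrix.posSemidef_of_forall_fin_sum_nonneg hsymm hpsd).map_pow hp).sum_sum_finset_nonneg
      B c
end
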